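/- Assume f₊₊ and f₋₋ are symmetric, f₊₋ is the transpose of f₋₊, and trace(f₊₊) = trace(f₋₋). Define the Ricci contraction Ric_{ab} = Σ_{c} R_{acbc}, the scalar S = Σ_{a} Ric_{aa}, and the Weyl tensor W_{abcd} = R_{abcd} − (1/2)(δ_{ac} Ric_{bd} − δ_{ad} Ric_{bc} − δ_{bc} Ric_{ad} + δ_{bd} Ric_{ac}) + (S/6)(δ_{ac} δ_{bd} − δ_{ad} δ_{bc}). Then W_{abcd} = Σ_{i,j=1}^{3} ( f̃₊₊^{ij} η^i_{ab} η^j_{cd} + f̃₋₋^{ij} η̄^i_{ab} η̄^j_{cd} ), where f̃₊₊ = f₊₊ − (trace(f₊₊)/3) I and f̃₋₋ = f₋₋ − (trace(f₋₋)/3) I are the traceless parts. -/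

import Mathlib

noncomputable section

open Matrix

/-- Three-index Levi-Civita symbol on `Fin 3` (ε₁₂₃ = 1, zero-indexed as ε₀₁₂ = 1). -/
def eps3 (i j k : Fin 3) : ℝ :=
  ((j : ℝ) - (i : ℝ)) * ((k : ℝ) - (i : ℝ)) * ((k : ℝ) - (j : ℝ)) / 2

/-- Four-index Levi-Civita symbol on `Fin 4` (ε₁₂₃₄ = 1, zero-indexed as ε₀₁₂₃ = 1). -/
def eps4 (a b c d : Fin 4) : ℝ :=
  ((b : ℝ) - (a : ℝ)) * ((c : ℝ) - (a : ℝ)) * ((d : ℝ) - (a : ℝ)) *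
    ((c : ℝ) - (b : ℝ)) * ((d : ℝ) - (b : ℝ)) * ((d : ℝ) - (c : ℝ)) / 12

/-- 't Hooft symbol η^i_{ab}: η^i_{jk} = ε_{ijk}, η^i_{j4} = δ_{ij}, η^i_{4j} = -δ_{ij},
η^i_{44} = 0 (the index `4` of the paper is the index `3 : Fin 4` here). -/
def tHooft (i : Fin 3) (a b : Fin 4) : ℝ :=
  if ha : (a : ℕ) < 3 then
    if hb : (b : ℕ) < 3 then eps3 i ⟨a, ha⟩ ⟨b, hb⟩
    else if (a : ℕ) = (i : ℕ) then 1 else 0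
  else
    if (b : ℕ) < 3 then (if (b : ℕ) = (i : ℕ) then -1 else 0)
    else 0

/-- 't Hooft symbol η̄^i_{ab}: η̄^i_{jk} = ε_{ijk}, η̄^i_{j4} = -δ_{ij}, η̄^i_{4j} = δ_{ij},
η̄^i_{44} = 0. -/
def tHooftBar (i : Fin 3) (a b : Fin 4) : ℝ :=
  if ha : (a : ℕ) < 3 then
    if hb : (b : ℕ) < 3 then eps3 i ⟨a, ha⟩ ⟨b, hb⟩
    else if (a : ℕ) = (i : ℕ) then -1 else 0
  else
    if (b : ℕ) < 3 then (if (b : ℕ) = (i : ℕ) then 1 else 0)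
    else 0

/-- The curvature-type tensor built from 3×3 matrices f₊₊, f₊₋, f₋₊, f₋₋ via the
't Hooft symbols. -/
def Riem (fpp fpm fmp fmm : Matrix (Fin 3) (Fin 3) ℝ) (a b c d : Fin 4) : ℝ :=
  ∑ i : Fin 3, ∑ j : Fin 3,
    (fpp i j * tHooft i a b * tHooft j c d
      + fpm i j * tHooft i a b * tHooftBar j c d
      + fmp i j * tHooftBar i a b * tHooft j c d
      + fmm i j * tHooftBar i a b * tHooftBar j c d)

/-- The 't Hooft symbols with integer entries. -/
def intTHooft : Fin 3 → Fin 4 → Fin 4 → ℤ :=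
  ![![![0, 0, 0, 1], ![0, 0, 1, 0], ![0, -1, 0, 0], ![-1, 0, 0, 0]],
    ![![0, 0, -1, 0], ![0, 0, 0, 1], ![1, 0, 0, 0], ![0, -1, 0, 0]],
    ![![0, 1, 0, 0], ![-1, 0, 0, 0], ![0, 0, 0, 1], ![0, 0, -1, 0]]]

/-- The conjugate 't Hooft symbols with integer entries. -/
def intTHooftBar : Fin 3 → Fin 4 → Fin 4 → ℤ :=
  ![![![0, 0, 0, -1], ![0, 0, 1, 0], ![0, -1, 0, 0], ![1, 0, 0, 0]],
    ![![0, 0, -1, 0], ![0, 0, 0, -1], ![1, 0, 0, 0], ![0, 1, 0, 0]],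
    ![![0, 1, 0, 0], ![-1, 0, 0, 0], ![0, 0, 0, -1], ![0, 0, 1, 0]]]

theorem tHooft_eq_intCast (i : Fin 3) (a b : Fin 4) : tHooft i a b = intTHooft i a b := by
  fin_cases i <;> fin_cases a <;> fin_cases b <;> norm_num [tHooft, eps3, intTHooft]

theorem tHooftBar_eq_intCast (i : Fin 3) (a b : Fin 4) :
    tHooftBar i a b = intTHooftBar i a b := by
  fin_cases i <;> fin_cases a <;> fin_cases b <;> norm_num [tHooftBar, eps3, intTHooftBar]

/-- The contraction `∑ c, η^i_{ac} η̄^j_{bc}`. -/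
def mixedContraction (i j : Fin 3) (a b : Fin 4) : ℝ :=
  ∑ c : Fin 4, tHooft i a c * tHooftBar j b c

theorem sum_tHooft_mul_tHooft_symm (i j : Fin 3) (a b : Fin 4) :
    ∑ c, tHooft i a c * tHooft j b c + ∑ c, tHooft j a c * tHooft i b c =
      2 * (if i = j then 1 else 0) * (if a = b then 1 else 0) := by
  simp only [tHooft_eq_intCast]
  norm_cast
  revert i j a b
  decide +kernel

theorem sum_tHooftBar_mul_tHooftBar_symm (i j : Fin 3) (a b : Fin 4) :
    ∑ c, tHooftBar i a c * tHooftBar j b c + ∑ c, tHooftBar j a c * tHooftBar i b c =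
      2 * (if i = j then 1 else 0) * (if a = b then 1 else 0) := by
  simp only [tHooftBar_eq_intCast]
  norm_cast
  revert i j a b
  decide +kernel

theorem sum_tHooftBar_mul_tHooft (i j : Fin 3) (a b : Fin 4) :
    ∑ c, tHooftBar j a c * tHooft i b c = mixedContraction i j a b := by
  simp only [mixedContraction, tHooft_eq_intCast, tHooftBar_eq_intCast]
  norm_cast
  revert i j a b
  decide +kernel

theorem sum_mixedContraction_diag (i j : Fin 3) : ∑ a, mixedContraction i j a a = 0 := by
  simp only [mixedContraction, tHooft_eq_intCast, tHooftBar_eq_intCast]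
  norm_cast
  revert i j
  decide +kernel

theorem tHooft_mul_tHooftBar_add (i j : Fin 3) (a b c d : Fin 4) :
    tHooft i a b * tHooftBar j c d + tHooftBar j a b * tHooft i c d =
      (if a = c then 1 else 0) * mixedContraction i j b d
        - (if a = d then 1 else 0) * mixedContraction i j b c
        - (if b = c then 1 else 0) * mixedContraction i j a d
        + (if b = d then 1 else 0) * mixedContraction i j a c := by
  simp only [mixedContraction, tHooft_eq_intCast, tHooftBar_eq_intCast]
  norm_cast
  revert i j a b c d
  decide +kernel

theorem sum_tHooft_mul_add_sum_tHooftBar_mul (a b c d : Fin 4) :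
    ∑ i, tHooft i a b * tHooft i c d + ∑ i, tHooftBar i a b * tHooftBar i c d =
      2 * ((if a = c then 1 else 0) * (if b = d then 1 else 0)
        - (if a = d then 1 else 0) * (if b = c then 1 else 0)) := by
  simp only [tHooft_eq_intCast, tHooftBar_eq_intCast]
  norm_cast
  revert a b c d
  decide +kernel

/-- A symmetric matrix contracted with `A`, whose symmetrization is a multiple of the identity,
only sees its trace. -/
theorem sum_mul_eq_trace_mul {n : Type*} [Fintype n] [DecidableEq n] {f : Matrix n n ℝ}
    (hf : f.IsSymm) {A : n → n → ℝ} {t : ℝ}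
    (hA : ∀ i j, A i j + A j i = 2 * (if i = j then 1 else 0) * t) :
    ∑ i, ∑ j, f i j * A i j = f.trace * t := by
  have hswap : ∑ i, ∑ j, f i j * A i j = ∑ i, ∑ j, f i j * A j i := by
    rw [Finset.sum_comm]
    simp only [hf.apply]
  have hadd : ∑ i, ∑ j, f i j * A i j + ∑ i, ∑ j, f i j * A j i = 2 * (f.trace * t) := by
    simp only [← Finset.sum_add_distrib, ← mul_add, hA]
    simp [Matrix.trace, Finset.sum_mul, Finset.mul_sum, mul_left_comm]
  linarith

theorem sum_Riem {fpp fmp fmm : Matrix (Fin 3) (Fin 3) ℝ} (hpp : fpp.IsSymm) (hmm : fmm.IsSymm)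
    (a b : Fin 4) :
    ∑ c, Riem fpp fmpᵀ fmp fmm a c b c =
      (fpp.trace + fmm.trace) * (if a = b then 1 else 0)
        + 2 * ∑ i, ∑ j, fmp j i * mixedContraction i j a b := by
  have hsum : ∑ c, Riem fpp fmpᵀ fmp fmm a c b c =
      ∑ i, ∑ j, fpp i j * ∑ c, tHooft i a c * tHooft j b c
        + ∑ i, ∑ j, fmp j i * mixedContraction i j a b
        + ∑ i, ∑ j, fmp i j * ∑ c, tHooftBar i a c * tHooft j b c
        + ∑ i, ∑ j, fmm i j * ∑ c, tHooftBar i a c * tHooftBar j b c := by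
    simp only [Riem, mixedContraction, Matrix.transpose_apply, ← Finset.sum_add_distrib]
    rw [Finset.sum_comm]
    refine Finset.sum_congr rfl fun i _ => ?_
    rw [Finset.sum_comm]
    refine Finset.sum_congr rfl fun j _ => ?_
    simp only [Finset.sum_add_distrib, Finset.mul_sum, mul_assoc]
  rw [hsum, sum_mul_eq_trace_mul hpp fun i j => sum_tHooft_mul_tHooft_symm i j a b,
    sum_mul_eq_trace_mul hmm fun i j => sum_tHooftBar_mul_tHooftBar_symm i j a b]
  simp only [sum_tHooftBar_mul_tHooft]
  rw [Finset.sum_comm (f := fun i j => fmp i j * mixedContraction j i a b)]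
  ring

/-- The Weyl tensor built from the curvature-type tensor decomposes through the traceless
parts of f₊₊ and f₋₋. -/
theorem weyl_decomposition (fpp fpm fmp fmm : Matrix (Fin 3) (Fin 3) ℝ)
    (hpp : fpp.IsSymm) (hmm : fmm.IsSymm) (hpm : fpm = fmpᵀ)
    (htr : fpp.trace = fmm.trace)
    (Ric : Fin 4 → Fin 4 → ℝ)
    (hRic : ∀ a b : Fin 4, Ric a b = ∑ c : Fin 4, Riem fpp fpm fmp fmm a c b c)
    (S : ℝ) (hS : S = ∑ a : Fin 4, Ric a a)
    (W : Fin 4 → Fin 4 → Fin 4 → Fin 4 → ℝ)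
    (hW : ∀ a b c d : Fin 4,
      W a b c d = Riem fpp fpm fmp fmm a b c d
        - (1 / 2) * ((if a = c then (1 : ℝ) else 0) * Ric b d
            - (if a = d then (1 : ℝ) else 0) * Ric b c
            - (if b = c then (1 : ℝ) else 0) * Ric a d
            + (if b = d then (1 : ℝ) else 0) * Ric a c)
        + (S / 6) * ((if a = c then (1 : ℝ) else 0) * (if b = d then (1 : ℝ) else 0)
            - (if a = d then (1 : ℝ) else 0) * (if b = c then (1 : ℝ) else 0))) :
    ∀ a b c d : Fin 4,
      W a b c d = ∑ i : Fin 3, ∑ j : Fin 3,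
        ((fpp i j - (fpp.trace / 3) * (if i = j then 1 else 0)) * tHooft i a b * tHooft j c d
          + (fmm i j - (fmm.trace / 3) * (if i = j then 1 else 0))
              * tHooftBar i a b * tHooftBar j c d) := by
  subst hpm
  replace hRic : ∀ a b, Ric a b = 2 * fpp.trace * (if a = b then 1 else 0)
      + 2 * ∑ i, ∑ j, fmp j i * mixedContraction i j a b := by
    intro a b
    rw [hRic, sum_Riem hpp hmm, ← htr]
    ring
  replace hS : S = 8 * fpp.trace := by
    have hmix : ∑ a, ∑ i, ∑ j, fmp j i * mixedContraction i j a a = 0 := by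
      rw [Finset.sum_comm]
      refine Finset.sum_eq_zero fun i _ => ?_
      rw [Finset.sum_comm]
      refine Finset.sum_eq_zero fun j _ => ?_
      rw [← Finset.mul_sum, sum_mixedContraction_diag, mul_zero]
    simp only [hS, hRic, Finset.sum_add_distrib, ← Finset.mul_sum, hmix]
    simp
    ring
  intro a b c d
  have hdiag := sum_tHooft_mul_add_sum_tHooftBar_mul a b c d
  have hmix : ∑ i, ∑ j, fmp j i *
      (tHooft i a b * tHooftBar j c d + tHooftBar j a b * tHooft i c d) =
      (if a = c then 1 else 0) * ∑ i, ∑ j, fmp j i * mixedContraction i j b d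
        - (if a = d then 1 else 0) * ∑ i, ∑ j, fmp j i * mixedContraction i j b c
        - (if b = c then 1 else 0) * ∑ i, ∑ j, fmp j i * mixedContraction i j a d
        + (if b = d then 1 else 0) * ∑ i, ∑ j, fmp j i * mixedContraction i j a c := by
    simp only [tHooft_mul_tHooftBar_add, Finset.mul_sum, ← Finset.sum_add_distrib,
      ← Finset.sum_sub_distrib]
    refine Finset.sum_congr rfl fun i _ => Finset.sum_congr rfl fun j _ => ?_
    ring
  have hRiem : Riem fpp fmpᵀ fmp fmm a b c d =
      ∑ i, ∑ j, (fpp i j * tHooft i a b * tHooft j c d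
        + fmm i j * tHooftBar i a b * tHooftBar j c d)
      + ∑ i, ∑ j, fmp j i *
        (tHooft i a b * tHooftBar j c d + tHooftBar j a b * tHooft i c d) := by
    simp only [Riem, Matrix.transpose_apply, Fin.sum_univ_three]
    ring
  have hrhs : ∑ i : Fin 3, ∑ j : Fin 3,
        ((fpp i j - (fpp.trace / 3) * (if i = j then 1 else 0)) * tHooft i a b * tHooft j c d
          + (fmm i j - (fmm.trace / 3) * (if i = j then 1 else 0))
              * tHooftBar i a b * tHooftBar j c d) =
      ∑ i, ∑ j, (fpp i j * tHooft i a b * tHooft j c d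
        + fmm i j * tHooftBar i a b * tHooftBar j c d)
      - fpp.trace / 3 * (∑ i, tHooft i a b * tHooft i c d
        + ∑ i, tHooftBar i a b * tHooftBar i c d) := by
    rw [← htr]
    generalize fpp.trace = t
    simp [Fin.sum_univ_three]
    ring
  rw [hW, hrhs, hdiag, hRiem, hmix, hS]
  simp only [hRic]
  ring
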